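/- arXiv:2012.04435 — 2 statements merged into one kernel-verified Lean document; each statement's English description precedes it below -/
import Mathlib

section
/- Let n ≥ 1, let l > 0, κ ≥ 0, and let γ₁, γ₂ : ℝ → ℝⁿ be curves that are differentiable at every point of the interval [0, l] and whose derivatives γ₁′, γ₂′ are κ-Lipschitz on [0, l]. Suppose ε is a real number with 0 ≤ ε < l²/4 and ‖γ₁(s) − γ₂(s)‖ ≤ ε for every s ∈ [0, l]. Then for every s ∈ [0, l] one has ‖γ₁′(s) − γ₂′(s)‖ ≤ (κ + 2)·√ε. -/
open Set Filter Topology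

/-- First-order Taylor estimate with the sharp constant `K / 2`. -/
theorem norm_sub_sub_smul_le_of_norm_deriv_sub_le {E : Type*} [NormedAddCommGroup E]
    [NormedSpace ℝ E] {f f' : ℝ → E} {K t : ℝ} (ht : 0 ≤ t)
    (hf : ∀ x ∈ Icc 0 t, HasDerivAt f (f' x) x)
    (hf' : ∀ x ∈ Icc 0 t, ‖f' x - f' 0‖ ≤ K * x) :
    ‖f t - f 0 - t • f' 0‖ ≤ K * t ^ 2 / 2 := by
  have hd : ∀ x ∈ Icc 0 t,
      HasDerivAt (fun y => f y - f 0 - y • f' 0) (f' x - f' 0) x := fun x hx => by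
    simpa using ((hf x hx).sub_const (f 0)).fun_sub ((hasDerivAt_id x).smul_const (f' 0))
  have hB : ∀ x, HasDerivAt (fun y : ℝ => K * y ^ 2 / 2) (K * x) x := fun x => by
    exact (((hasDerivAt_pow 2 x).const_mul K).div_const 2).congr_deriv (by norm_num; ring)
  exact image_norm_le_of_norm_deriv_right_le_deriv_boundary
    (fun x hx => (hd x hx).continuousAt.continuousWithinAt)
    (fun x hx => (hd x (Ico_subset_Icc_self hx)).hasDerivWithinAt)
    (by simp) hB (fun x hx => hf' x (Ico_subset_Icc_self hx)) (right_mem_Icc.2 ht)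

/-- Interpolation inequality: a function bounded by `ε` whose derivative is `K`-Lipschitz has
derivative at most `2 * ε / t + K * t / 2` at a point with room `t` on one side. -/
theorem mul_norm_deriv_le_of_norm_le {E : Type*} [NormedAddCommGroup E]
    [NormedSpace ℝ E] {f f' : ℝ → E} {S : Set ℝ} [S.OrdConnected] {K ε s t σ : ℝ} (ht : 0 ≤ t)
    (hσ : |σ| = 1) (hs : s ∈ S) (hst : s + σ * t ∈ S)
    (hf : ∀ x ∈ S, HasDerivAt f (f' x) x)
    (hf' : ∀ x ∈ S, ∀ y ∈ S, ‖f' x - f' y‖ ≤ K * |x - y|)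
    (hε : ∀ x ∈ S, ‖f x‖ ≤ ε) :
    t * ‖f' s‖ ≤ 2 * ε + K * t ^ 2 / 2 := by
  have hmem : ∀ x ∈ Icc 0 t, s + σ * x ∈ S := fun x hx => by
    refine OrdConnected.uIcc_subset ‹_› hs hst ?_
    rw [mem_uIcc]
    rcases eq_or_eq_neg_of_abs_eq hσ with rfl | rfl
    · left; constructor <;> linarith [hx.1, hx.2]
    · right; constructor <;> linarith [hx.1, hx.2]
  have key := norm_sub_sub_smul_le_of_norm_deriv_sub_le (f := fun x => f (s + σ * x))
    (f' := fun x => σ • f' (s + σ * x)) (K := K) ht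
    (fun x hx => (hf _ (hmem x hx)).scomp x
      (by simpa using ((hasDerivAt_id x).const_mul σ).const_add s))
    (fun x hx => by
      rw [← smul_sub, norm_smul, Real.norm_eq_abs, hσ, one_mul]
      simpa [abs_mul, hσ, abs_of_nonneg hx.1] using hf' _ (hmem x hx) s hs)
  simp only [mul_zero, add_zero] at key
  have hnorm : ‖t • σ • f' s‖ = t * ‖f' s‖ := by
    rw [norm_smul, norm_smul, Real.norm_eq_abs, Real.norm_eq_abs, hσ, one_mul, abs_of_nonneg ht]
  have h₁ := norm_sub_norm_le (t • σ • f' s) (f (s + σ * t) - f s)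
  rw [norm_sub_rev (t • σ • f' s), hnorm] at h₁
  linarith [norm_sub_le (f (s + σ * t)) (f s), hε _ hs, hε _ hst]

theorem stmt_0 (n : ℕ) (hn : 1 ≤ n) (l κ ε : ℝ) (hl : 0 < l) (hκ : 0 ≤ κ)
    (γ₁ γ₂ g₁ g₂ : ℝ → EuclideanSpace ℝ (Fin n))
    (hγ₁ : ∀ s ∈ Set.Icc (0:ℝ) l, HasDerivAt γ₁ (g₁ s) s)
    (hγ₂ : ∀ s ∈ Set.Icc (0:ℝ) l, HasDerivAt γ₂ (g₂ s) s)
    (hg₁ : ∀ s ∈ Set.Icc (0:ℝ) l, ∀ t ∈ Set.Icc (0:ℝ) l, ‖g₁ s - g₁ t‖ ≤ κ * |s - t|)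
    (hg₂ : ∀ s ∈ Set.Icc (0:ℝ) l, ∀ t ∈ Set.Icc (0:ℝ) l, ‖g₂ s - g₂ t‖ ≤ κ * |s - t|)
    (hε : 0 ≤ ε) (hεl : ε < l ^ 2 / 4)
    (hclose : ∀ s ∈ Set.Icc (0:ℝ) l, ‖γ₁ s - γ₂ s‖ ≤ ε) :
    ∀ s ∈ Set.Icc (0:ℝ) l, ‖g₁ s - g₂ s‖ ≤ (κ + 2) * Real.sqrt ε := by
  intro s hs
  have hbound : ∀ t ∈ Ioo (√ε) (l / 2), ‖g₁ s - g₂ s‖ ≤ κ * t + 2 * √ε := fun t ht => by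
    have ht₀ : 0 < t := (Real.sqrt_nonneg ε).trans_lt ht.1
    obtain ⟨σ, hσ, hst⟩ : ∃ σ : ℝ, |σ| = 1 ∧ s + σ * t ∈ Icc 0 l := by
      rcases le_total s (l / 2) with h | h
      · exact ⟨1, by simp, by constructor <;> linarith [hs.1, ht.2]⟩
      · exact ⟨-1, by simp, by constructor <;> linarith [hs.2, ht.2]⟩
    have h := mul_norm_deriv_le_of_norm_le (f := fun x => γ₁ x - γ₂ x)
      (f' := fun x => g₁ x - g₂ x) (K := 2 * κ) ht₀.le hσ hs hst
      (fun x hx => (hγ₁ x hx).sub (hγ₂ x hx))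
      (fun x hx y hy => by
        rw [sub_sub_sub_comm]
        linarith [norm_sub_le (g₁ x - g₁ y) (g₂ x - g₂ y), hg₁ x hx y hy, hg₂ x hx y hy])
      hclose
    refine le_of_mul_le_mul_left ?_ ht₀
    nlinarith [Real.mul_self_sqrt hε, mul_le_mul_of_nonneg_right ht.1.le (Real.sqrt_nonneg ε)]
  have hlt : √ε < l / 2 := (Real.sqrt_lt' (by positivity)).2 (by linarith)
  have hlim : Tendsto (fun t => κ * t + 2 * √ε) (𝓝[>] √ε) (𝓝 (κ * √ε + 2 * √ε)) :=
    Continuous.tendsto (by fun_prop) _ |>.mono_left nhdsWithin_le_nhds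
  rw [add_mul]
  exact ge_of_tendsto hlim (eventually_of_mem (Ioo_mem_nhdsGT hlt) hbound)
end

section
/- Let X be a metric space, let Γ₁ ⊆ X be a nonempty subset, let r > 0, and for each integer j ≥ 1 define the level set Γ_j = {x ∈ X : infDist(x, Γ₁) = (j − 1)·r}. Let i ≥ 2 be an integer and let z ∈ Γ_i, so that infDist(z, Γ₁) = (i − 1)·r. Suppose there exists a map γ : ℝ → X with γ(0) = z, γ((i − 1)·r) ∈ Γ₁, and dist(γ(s), γ(t)) = |s − t| for all s, t ∈ [0, (i − 1)·r] (a unit-speed minimizing curve from z to Γ₁). Then infDist(z, Γ_{i−1}) = r. -/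
theorem stmt_6 {X : Type*} [MetricSpace X] (Γ₁ : Set X) (h1 : Γ₁.Nonempty)
    (r : ℝ) (hr : 0 < r) (Γ : ℕ → Set X)
    (hΓ : ∀ j : ℕ, 1 ≤ j → Γ j = {x : X | Metric.infDist x Γ₁ = ((j : ℝ) - 1) * r})
    (i : ℕ) (hi : 2 ≤ i) (z : X) (hz : z ∈ Γ i)
    (γ : ℝ → X) (hγ0 : γ 0 = z) (hγend : γ (((i : ℝ) - 1) * r) ∈ Γ₁)
    (hiso : ∀ s ∈ Set.Icc (0:ℝ) (((i : ℝ) - 1) * r), ∀ t ∈ Set.Icc (0:ℝ) (((i : ℝ) - 1) * r),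
      dist (γ s) (γ t) = |s - t|) :
    Metric.infDist z (Γ (i - 1)) = r := by
  have hcast : ((i - 1 : ℕ) : ℝ) = (i : ℝ) - 1 := by
    rw [Nat.cast_sub (by lia), Nat.cast_one]
  have hi' : (2 : ℝ) ≤ i := by exact_mod_cast hi
  have hrL : r ≤ ((i : ℝ) - 1) * r := by nlinarith
  rw [hΓ i (by lia), Set.mem_ofPred_eq] at hz
  have hprev : Γ (i - 1) = {x : X | Metric.infDist x Γ₁ = ((i : ℝ) - 1 - 1) * r} := by
    rw [hΓ (i - 1) (by lia), hcast]
  have hdist : dist z (γ r) = r := by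
    rw [← hγ0, hiso 0 ⟨le_rfl, hr.le.trans hrL⟩ r ⟨hr.le, hrL⟩, zero_sub, abs_neg,
      abs_of_pos hr]
  have hmem : γ r ∈ Γ (i - 1) := by
    rw [hprev, Set.mem_ofPred_eq]
    apply le_antisymm
    · have h := Metric.infDist_le_dist_of_mem (x := γ r) hγend
      rw [hiso r ⟨hr.le, hrL⟩ _ ⟨hr.le.trans hrL, le_rfl⟩, abs_sub_comm,
        abs_of_nonneg (sub_nonneg.2 hrL)] at h
      linarith
    · have h := Metric.infDist_le_infDist_add_dist (s := Γ₁) (x := z) (y := γ r)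
      linarith
  apply le_antisymm
  · exact (Metric.infDist_le_dist_of_mem hmem).trans_eq hdist
  · refine (Metric.le_infDist ⟨_, hmem⟩).2 fun y hy => ?_
    rw [hprev, Set.mem_ofPred_eq] at hy
    have h := Metric.infDist_le_infDist_add_dist (s := Γ₁) (x := z) (y := y)
    linarith
end
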